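/- Let p > 1 with p ≠ Q, and let w ∈ ℍⁿ. Then the function v_w(z) = ρ(w⁻¹·z)^{−(Q−p)/(p−1)} is weakly horizontally p-harmonic in ℍⁿ∖{w}. -/

import Mathlib

open MeasureTheory Real Set

noncomputable section

/-- The underlying space of the Heisenberg group `ℍⁿ`, i.e. `ℝ^(2n+1)`,
with coordinates `(x₁, …, xₙ, y₁, …, yₙ, t)`. -/
abbrev Heis (n : ℕ) := Fin (2 * n + 1) → ℝ

namespace Heis

variable {n : ℕ}

/-- The index of the coordinate `xᵢ`. -/
def xIdx (n : ℕ) (i : Fin n) : Fin (2 * n + 1) := ⟨(i : ℕ), by have := i.isLt; omega⟩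

/-- The index of the coordinate `yᵢ`. -/
def yIdx (n : ℕ) (i : Fin n) : Fin (2 * n + 1) := ⟨n + (i : ℕ), by have := i.isLt; omega⟩

/-- The index of the coordinate `t`. -/
def tIdx (n : ℕ) : Fin (2 * n + 1) := ⟨2 * n, by omega⟩

/-- The Heisenberg group product. -/
def mul (z w : Heis n) : Heis n := fun k =>
  if (k : ℕ) = 2 * n then
    z k + w k + 2 * ∑ i : Fin n,
      (w (xIdx n i) * z (yIdx n i) - z (xIdx n i) * w (yIdx n i))
  else z k + w k

/-- The Heisenberg group inverse. -/
def inv (z : Heis n) : Heis n := fun k => - z k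

/-- The Koranyi gauge `ρ`. -/
def rho (z : Heis n) : ℝ :=
  ((∑ i : Fin n, (z (xIdx n i) ^ 2 + z (yIdx n i) ^ 2)) ^ 2 + z (tIdx n) ^ 2) ^ ((1 : ℝ) / 4)

/-- The gauge ball `B_ρ(z, R) = {w | ρ(w⁻¹ ⬝ z) < R}`. -/
def gaugeBall (z : Heis n) (R : ℝ) : Set (Heis n) := {w | rho (mul (inv w) z) < R}

/-- The anisotropic dilations `δ_λ`. -/
def dil (lam : ℝ) (z : Heis n) : Heis n := fun k =>
  if (k : ℕ) = 2 * n then Real.exp (2 * lam) * z k else Real.exp lam * z k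

/-- The dilation-generating vector field `Z(z) = (x₁, …, xₙ, y₁, …, yₙ, 2t)`. -/
def Zvf (z : Heis n) : Heis n := fun k => if (k : ℕ) = 2 * n then 2 * z k else z k

/-- The Euclidean scalar product of `ℝ^(2n+1)`. -/
def einner (v w : Heis n) : ℝ := ∑ k, v k * w k

/-- The Euclidean norm of `ℝ^(2n+1)`. -/
def euclNorm (v : Heis n) : ℝ := Real.sqrt (∑ k, v k ^ 2)

/-- The Euclidean gradient of `f`, via the Fréchet derivative. -/
def grad (f : Heis n → ℝ) (z : Heis n) : Heis n := fun k => fderiv ℝ f z (Pi.single k 1)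

/-- The horizontal derivative `Xᵢ f = ∂f/∂xᵢ + 2 yᵢ ∂f/∂t`. -/
def Xd (i : Fin n) (f : Heis n → ℝ) (z : Heis n) : ℝ :=
  grad f z (xIdx n i) + 2 * z (yIdx n i) * grad f z (tIdx n)

/-- The horizontal derivative `Yⱼ f = ∂f/∂yⱼ − 2 xⱼ ∂f/∂t`. -/
def Yd (i : Fin n) (f : Heis n → ℝ) (z : Heis n) : ℝ :=
  grad f z (yIdx n i) - 2 * z (xIdx n i) * grad f z (tIdx n)

/-- The horizontal gradient `∇_ℍ f = (X₁ f, …, Xₙ f, Y₁ f, …, Yₙ f)`. -/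
def hGrad (f : Heis n → ℝ) (z : Heis n) : (Fin n → ℝ) × (Fin n → ℝ) :=
  (fun i => Xd i f z, fun i => Yd i f z)

/-- The norm `|∇_ℍ f|` of the horizontal gradient. -/
def hNorm (f : Heis n → ℝ) (z : Heis n) : ℝ :=
  Real.sqrt (∑ i : Fin n, ((Xd i f z) ^ 2 + (Yd i f z) ^ 2))

/-- `f` is weakly horizontally `p`-harmonic on the open set `U` :
`f` and `∇_ℍ f` are locally `p`-integrable on `U` and
`∫_U |∇_ℍ f|^(p−2) ⟨∇_ℍ f, ∇_ℍ φ⟩ = 0` for every `C¹` function `φ`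
with compact support contained in `U` (note that `Real.rpow` makes the
integrand vanish at points where `∇_ℍ f = 0`). -/
def PHarmonicOn (p : ℝ) (f : Heis n → ℝ) (U : Set (Heis n)) : Prop :=
  LocallyIntegrableOn (fun z => |f z| ^ p) U volume ∧
  LocallyIntegrableOn (fun z => hNorm f z ^ p) U volume ∧
  ∀ φ : Heis n → ℝ, ContDiff ℝ 1 φ → HasCompactSupport φ → tsupport φ ⊆ U →
    ∫ z in U, hNorm f z ^ (p - 2) *
      (∑ i : Fin n, (Xd i f z * Xd i φ z + Yd i f z * Yd i φ z)) = 0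

/-- `Ω` has `C¹` boundary, with Euclidean outward unit normal `ν` on `∂Ω` :
near every boundary point, `Ω` is the sublevel set of a `C¹` defining function
with nonvanishing (Euclidean) gradient, and `ν` is the normalized gradient. -/
def HasC1Boundary (Ω : Set (Heis n)) (ν : Heis n → Heis n) : Prop :=
  ∀ z ∈ frontier Ω, ∃ (V : Set (Heis n)) (g : Heis n → ℝ),
    IsOpen V ∧ z ∈ V ∧ ContDiff ℝ 1 g ∧
    (∀ w ∈ V, (w ∈ interior Ω ↔ g w < 0)) ∧
    (∀ w ∈ V, (w ∈ frontier Ω ↔ g w = 0)) ∧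
    (∀ w ∈ V, w ∈ frontier Ω →
      grad g w ≠ 0 ∧ ν w = (euclNorm (grad g w))⁻¹ • grad g w)

/-- `Ω` (with `C¹` boundary and Euclidean outward unit normal `ν`) is strictly
starshaped with respect to the origin : it contains the origin and `⟨ν, Z⟩ > 0`
everywhere on `∂Ω`. -/
def StrictStarshaped (Ω : Set (Heis n)) (ν : Heis n → Heis n) : Prop :=
  (0 : Heis n) ∈ Ω ∧ HasC1Boundary Ω ν ∧
    ∀ z ∈ frontier Ω, 0 < einner (ν z) (Zvf z)

/-- `Ω` satisfies the exterior gauge ball property at `z ∈ ∂Ω`, with exterior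
tangent gauge ball `B_ρ(z₁, R)`. -/
def ExteriorGaugeBallAt (Ω : Set (Heis n)) (z z₁ : Heis n) (R : ℝ) : Prop :=
  z₁ ∉ closure Ω ∧ gaugeBall z₁ R ⊆ (closure Ω)ᶜ ∧
    closure (gaugeBall z₁ R) ∩ frontier Ω = {z}

/-- `Ω` satisfies a uniform exterior gauge ball property. -/
def UniformExteriorGaugeBall (Ω : Set (Heis n)) : Prop :=
  ∃ R > 0, ∀ z ∈ frontier Ω, ∃ z₁, ExteriorGaugeBallAt Ω z z₁ R

/-- `Ω` satisfies the interior gauge ball property at `z ∈ ∂Ω`, with interior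
tangent gauge ball `B_ρ(z₂, R)`. -/
def InteriorGaugeBallAt (Ω : Set (Heis n)) (z z₂ : Heis n) (R : ℝ) : Prop :=
  z₂ ∈ Ω ∧ gaugeBall z₂ R ⊆ Ω ∧ closure (gaugeBall z₂ R) ∩ frontier Ω = {z}

/-- `Ω` satisfies a uniform interior gauge ball property. -/
def UniformInteriorGaugeBall (Ω : Set (Heis n)) : Prop :=
  ∃ R > 0, ∀ z ∈ frontier Ω, ∃ z₂, InteriorGaugeBallAt Ω z z₂ R

end Heis

namespace Heis

variable {n : ℕ}

lemma xIdx_ne_tIdx (i : Fin n) : xIdx n i ≠ tIdx n := fun h => by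
  have := i.isLt; have := congrArg Fin.val h; simp only [xIdx, tIdx] at this; omega

lemma yIdx_ne_tIdx (i : Fin n) : yIdx n i ≠ tIdx n := fun h => by
  have := i.isLt; have := congrArg Fin.val h; simp only [yIdx, tIdx] at this; omega

lemma xIdx_ne_yIdx (i j : Fin n) : xIdx n i ≠ yIdx n j := fun h => by
  have := i.isLt; have := congrArg Fin.val h; simp only [xIdx, yIdx] at this; omega

/-- The squared Euclidean norm of the horizontal part of `w⁻¹ ⬝ z`. -/
def horizSq (w z : Heis n) : ℝ :=
  ∑ i : Fin n, ((z (xIdx n i) - w (xIdx n i)) ^ 2 + (z (yIdx n i) - w (yIdx n i)) ^ 2)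

/-- The `t`-coordinate of `w⁻¹ ⬝ z`. -/
def vert (w z : Heis n) : ℝ :=
  z (tIdx n) - w (tIdx n)
    + 2 * ∑ i : Fin n, (w (xIdx n i) * z (yIdx n i) - z (xIdx n i) * w (yIdx n i))

/-- The fourth power of the gauge of `w⁻¹ ⬝ z`. -/
def gaugeQuartic (w z : Heis n) : ℝ := horizSq w z ^ 2 + vert w z ^ 2

/-- A quarter of the horizontal derivative `Xᵢ` of `gaugeQuartic w`. -/
def xField (w : Heis n) (i : Fin n) (z : Heis n) : ℝ :=
  horizSq w z * (z (xIdx n i) - w (xIdx n i)) + vert w z * (z (yIdx n i) - w (yIdx n i))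

/-- A quarter of the horizontal derivative `Yᵢ` of `gaugeQuartic w`. -/
def yField (w : Heis n) (i : Fin n) (z : Heis n) : ℝ :=
  horizSq w z * (z (yIdx n i) - w (yIdx n i)) - vert w z * (z (xIdx n i) - w (xIdx n i))

lemma rho_mul_inv (w z : Heis n) : rho (mul (inv w) z) = gaugeQuartic w z ^ ((1 : ℝ) / 4) := by
  have hx : ∀ i : Fin n, ((xIdx n i : Fin (2 * n + 1)) : ℕ) ≠ 2 * n := fun i => by
    have := i.isLt; simp only [xIdx]; omega
  have hy : ∀ i : Fin n, ((yIdx n i : Fin (2 * n + 1)) : ℕ) ≠ 2 * n := fun i => by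
    have := i.isLt; simp only [yIdx]; omega
  have ht : ((tIdx n : Fin (2 * n + 1)) : ℕ) = 2 * n := rfl
  unfold rho gaugeQuartic horizSq vert mul inv
  simp only [hx, hy, ht, if_true, if_false]
  congr 2
  · congr 1
    exact Finset.sum_congr rfl fun i _ => by ring
  · congr 1
    have : ∑ i : Fin n, (z (xIdx n i) * -w (yIdx n i) - -w (xIdx n i) * z (yIdx n i))
        = ∑ i : Fin n, (w (xIdx n i) * z (yIdx n i) - z (xIdx n i) * w (yIdx n i)) :=
      Finset.sum_congr rfl fun i _ => by ring
    rw [this]; ring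

lemma horizSq_nonneg (w z : Heis n) : 0 ≤ horizSq w z :=
  Finset.sum_nonneg fun _ _ => by positivity

lemma gaugeQuartic_nonneg (w z : Heis n) : 0 ≤ gaugeQuartic w z := by
  unfold gaugeQuartic; positivity

lemma sq_add_sq_le_horizSq (w z : Heis n) (i : Fin n) :
    (z (xIdx n i) - w (xIdx n i)) ^ 2 + (z (yIdx n i) - w (yIdx n i)) ^ 2 ≤ horizSq w z :=
  Finset.single_le_sum
    (f := fun i => (z (xIdx n i) - w (xIdx n i)) ^ 2 + (z (yIdx n i) - w (yIdx n i)) ^ 2)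
    (fun _ _ => by positivity) (Finset.mem_univ i)

lemma eq_of_coords {w z : Heis n} (hx : ∀ i, z (xIdx n i) = w (xIdx n i))
    (hy : ∀ i, z (yIdx n i) = w (yIdx n i)) (ht : z (tIdx n) = w (tIdx n)) : z = w := by
  funext k
  rcases lt_or_ge (k : ℕ) n with h | h
  · exact hx ⟨k, h⟩
  rcases lt_or_ge (k : ℕ) (2 * n) with h' | h'
  · have : k = yIdx n ⟨k - n, by omega⟩ := by
      apply Fin.ext; simp only [yIdx]; omega
    rw [this]; exact hy _
  · have : k = tIdx n := by
      apply Fin.ext; have := k.isLt; simp only [tIdx]; omega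
    rw [this]; exact ht

lemma gaugeQuartic_pos {w z : Heis n} (h : z ≠ w) : 0 < gaugeQuartic w z := by
  refine (gaugeQuartic_nonneg w z).lt_of_ne' fun h0 => h ?_
  unfold gaugeQuartic at h0
  have hS : horizSq w z = 0 := by nlinarith [sq_nonneg (horizSq w z), sq_nonneg (vert w z)]
  have hT : vert w z = 0 := by nlinarith [sq_nonneg (horizSq w z), sq_nonneg (vert w z)]
  have hle := sq_add_sq_le_horizSq w z
  rw [hS] at hle
  have hx : ∀ i, z (xIdx n i) = w (xIdx n i) := fun i => by
    nlinarith [hle i, sq_nonneg (z (xIdx n i) - w (xIdx n i)),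
      sq_nonneg (z (yIdx n i) - w (yIdx n i))]
  have hy : ∀ i, z (yIdx n i) = w (yIdx n i) := fun i => by
    nlinarith [hle i, sq_nonneg (z (xIdx n i) - w (xIdx n i)),
      sq_nonneg (z (yIdx n i) - w (yIdx n i))]
  refine eq_of_coords hx hy ?_
  unfold vert at hT
  simp only [hx, hy, mul_comm, sub_self, Finset.sum_const_zero] at hT
  linarith

@[fun_prop]
lemma contDiff_horizSq (w : Heis n) {m : WithTop ℕ∞} : ContDiff ℝ m (horizSq w) := by
  unfold horizSq
  exact ContDiff.sum fun i _ => by fun_prop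

@[fun_prop]
lemma contDiff_vert (w : Heis n) {m : WithTop ℕ∞} : ContDiff ℝ m (vert w) := by
  unfold vert
  have : ContDiff ℝ m (fun z : Heis n =>
      ∑ i : Fin n, (w (xIdx n i) * z (yIdx n i) - z (xIdx n i) * w (yIdx n i))) :=
    ContDiff.sum fun i _ => by fun_prop
  fun_prop

@[fun_prop]
lemma contDiff_gaugeQuartic (w : Heis n) {m : WithTop ℕ∞} : ContDiff ℝ m (gaugeQuartic w) := by
  unfold gaugeQuartic; fun_prop

@[fun_prop]
lemma contDiff_xField (w : Heis n) (i : Fin n) {m : WithTop ℕ∞} :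
    ContDiff ℝ m (xField w i) := by
  unfold xField; fun_prop

@[fun_prop]
lemma contDiff_yField (w : Heis n) (i : Fin n) {m : WithTop ℕ∞} :
    ContDiff ℝ m (yField w i) := by
  unfold yField; fun_prop

/-- The direction of the vector field `Xᵢ` at `z`. -/
def xVec (i : Fin n) (z : Heis n) : Heis n :=
  Pi.single (xIdx n i) 1 + (2 * z (yIdx n i)) • Pi.single (tIdx n) 1

/-- The direction of the vector field `Yᵢ` at `z`. -/
def yVec (i : Fin n) (z : Heis n) : Heis n :=
  Pi.single (yIdx n i) 1 - (2 * z (xIdx n i)) • Pi.single (tIdx n) 1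

lemma Xd_eq_fderiv (i : Fin n) (f : Heis n → ℝ) (z : Heis n) :
    Xd i f z = fderiv ℝ f z (xVec i z) := by
  simp [Xd, grad, xVec]

lemma Yd_eq_fderiv (i : Fin n) (f : Heis n → ℝ) (z : Heis n) :
    Yd i f z = fderiv ℝ f z (yVec i z) := by
  simp [Yd, grad, yVec]

lemma xVec_x (i j : Fin n) (z : Heis n) : xVec i z (xIdx n j) = if i = j then 1 else 0 := by
  have h1 : xIdx n j ≠ tIdx n := xIdx_ne_tIdx j
  have h2 : xIdx n j = xIdx n i ↔ i = j := by
    simp [xIdx, Fin.ext_iff, eq_comm]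
  simp [xVec, Pi.single_apply, h1, h2]

lemma xVec_y (i j : Fin n) (z : Heis n) : xVec i z (yIdx n j) = 0 := by
  have h1 : yIdx n j ≠ tIdx n := yIdx_ne_tIdx j
  have h2 : yIdx n j ≠ xIdx n i := (xIdx_ne_yIdx i j).symm
  simp [xVec, h1, h2]

lemma xVec_t (i : Fin n) (z : Heis n) : xVec i z (tIdx n) = 2 * z (yIdx n i) := by
  have h2 : tIdx n ≠ xIdx n i := (xIdx_ne_tIdx i).symm
  simp [xVec, h2]

lemma yVec_y (i j : Fin n) (z : Heis n) : yVec i z (yIdx n j) = if i = j then 1 else 0 := by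
  have h1 : yIdx n j ≠ tIdx n := yIdx_ne_tIdx j
  have h2 : yIdx n j = yIdx n i ↔ i = j := by
    simp [yIdx, Fin.ext_iff, eq_comm]
  simp [yVec, Pi.single_apply, h1, h2]

lemma yVec_x (i j : Fin n) (z : Heis n) : yVec i z (xIdx n j) = 0 := by
  have h1 : xIdx n j ≠ tIdx n := xIdx_ne_tIdx j
  have h2 : xIdx n j ≠ yIdx n i := xIdx_ne_yIdx j i
  simp [yVec, h1, h2]

lemma yVec_t (i : Fin n) (z : Heis n) : yVec i z (tIdx n) = - (2 * z (xIdx n i)) := by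
  have h2 : tIdx n ≠ yIdx n i := (yIdx_ne_tIdx i).symm
  simp [yVec, h2]

lemma hasLineDerivAt_coord (k : Fin (2 * n + 1)) (z v : Heis n) :
    HasLineDerivAt ℝ (fun z : Heis n => z k) (v k) z v := by
  unfold HasLineDerivAt
  simpa using ((hasDerivAt_id (0 : ℝ)).mul_const (v k)).const_add (z k)

lemma hasLineDerivAt_horizSq (w z v : Heis n) :
    HasLineDerivAt ℝ (horizSq w)
      (∑ i : Fin n, (2 * (z (xIdx n i) - w (xIdx n i)) * v (xIdx n i)
        + 2 * (z (yIdx n i) - w (yIdx n i)) * v (yIdx n i))) z v := by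
  refine HasDerivAt.fun_sum fun i _ => ?_
  have h (k) := (HasDerivAt.sub_const (w k) (hasLineDerivAt_coord k z v)).fun_pow 2
  simpa using (h (xIdx n i)).fun_add (h (yIdx n i))

lemma hasLineDerivAt_vert (w z v : Heis n) :
    HasLineDerivAt ℝ (vert w)
      (v (tIdx n)
        + 2 * ∑ i : Fin n, (w (xIdx n i) * v (yIdx n i) - v (xIdx n i) * w (yIdx n i))) z v := by
  have h (k) : HasDerivAt _ _ _ := hasLineDerivAt_coord k z v
  refine ((h (tIdx n)).sub_const _).fun_add (HasDerivAt.const_mul 2 (HasDerivAt.fun_sum fun i _ => ?_))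
  exact ((h _).const_mul _).fun_sub ((h _).mul_const _)

lemma hasLineDerivAt_horizSq_xVec (w z : Heis n) (i : Fin n) :
    HasLineDerivAt ℝ (horizSq w) (2 * (z (xIdx n i) - w (xIdx n i))) z (xVec i z) := by
  simpa [xVec_x, xVec_y] using hasLineDerivAt_horizSq w z (xVec i z)

lemma hasLineDerivAt_horizSq_yVec (w z : Heis n) (i : Fin n) :
    HasLineDerivAt ℝ (horizSq w) (2 * (z (yIdx n i) - w (yIdx n i))) z (yVec i z) := by
  simpa [yVec_x, yVec_y] using hasLineDerivAt_horizSq w z (yVec i z)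

lemma hasLineDerivAt_vert_xVec (w z : Heis n) (i : Fin n) :
    HasLineDerivAt ℝ (vert w) (2 * (z (yIdx n i) - w (yIdx n i))) z (xVec i z) := by
  convert hasLineDerivAt_vert w z (xVec i z) using 1
  simp [xVec_x, xVec_y, xVec_t]; ring

lemma hasLineDerivAt_vert_yVec (w z : Heis n) (i : Fin n) :
    HasLineDerivAt ℝ (vert w) (-(2 * (z (xIdx n i) - w (xIdx n i)))) z (yVec i z) := by
  convert hasLineDerivAt_vert w z (yVec i z) using 1
  simp [yVec_x, yVec_y, yVec_t]; ring

lemma hasLineDerivAt_gaugeQuartic_xVec (w z : Heis n) (i : Fin n) :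
    HasLineDerivAt ℝ (gaugeQuartic w) (4 * xField w i z) z (xVec i z) := by
  have hS : HasDerivAt _ _ _ := hasLineDerivAt_horizSq_xVec w z i
  have hT : HasDerivAt _ _ _ := hasLineDerivAt_vert_xVec w z i
  refine ((hS.fun_pow 2).fun_add (hT.fun_pow 2)).congr_deriv ?_
  simp [xField]; ring

lemma hasLineDerivAt_gaugeQuartic_yVec (w z : Heis n) (i : Fin n) :
    HasLineDerivAt ℝ (gaugeQuartic w) (4 * yField w i z) z (yVec i z) := by
  have hS : HasDerivAt _ _ _ := hasLineDerivAt_horizSq_yVec w z i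
  have hT : HasDerivAt _ _ _ := hasLineDerivAt_vert_yVec w z i
  refine ((hS.fun_pow 2).fun_add (hT.fun_pow 2)).congr_deriv ?_
  simp [yField]; ring

lemma hasLineDerivAt_xField (w z : Heis n) (i : Fin n) :
    HasLineDerivAt ℝ (xField w i)
      (2 * (z (xIdx n i) - w (xIdx n i)) ^ 2 + horizSq w z
        + 2 * (z (yIdx n i) - w (yIdx n i)) ^ 2) z (xVec i z) := by
  have hS : HasDerivAt _ _ _ := hasLineDerivAt_horizSq_xVec w z i
  have hT : HasDerivAt _ _ _ := hasLineDerivAt_vert_xVec w z i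
  have h (k) : HasDerivAt _ _ _ := HasDerivAt.sub_const (w k) (hasLineDerivAt_coord k z (xVec i z))
  refine ((hS.fun_mul (h _)).fun_add (hT.fun_mul (h _))).congr_deriv ?_
  simp [xVec_x, xVec_y]; ring

lemma hasLineDerivAt_yField (w z : Heis n) (i : Fin n) :
    HasLineDerivAt ℝ (yField w i)
      (2 * (z (xIdx n i) - w (xIdx n i)) ^ 2 + horizSq w z
        + 2 * (z (yIdx n i) - w (yIdx n i)) ^ 2) z (yVec i z) := by
  have hS : HasDerivAt _ _ _ := hasLineDerivAt_horizSq_yVec w z i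
  have hT : HasDerivAt _ _ _ := hasLineDerivAt_vert_yVec w z i
  have h (k) : HasDerivAt _ _ _ := HasDerivAt.sub_const (w k) (hasLineDerivAt_coord k z (yVec i z))
  refine ((hS.fun_mul (h _)).fun_sub (hT.fun_mul (h _))).congr_deriv ?_
  simp [yVec_x, yVec_y]; ring

lemma Xd_eq_of_hasLineDerivAt {f : Heis n → ℝ} {z : Heis n} {i : Fin n} {d : ℝ}
    (hf : DifferentiableAt ℝ f z) (h : HasLineDerivAt ℝ f d z (xVec i z)) : Xd i f z = d := by
  rw [Xd_eq_fderiv, ← hf.lineDeriv_eq_fderiv, h.lineDeriv]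

lemma Yd_eq_of_hasLineDerivAt {f : Heis n → ℝ} {z : Heis n} {i : Fin n} {d : ℝ}
    (hf : DifferentiableAt ℝ f z) (h : HasLineDerivAt ℝ f d z (yVec i z)) : Yd i f z = d := by
  rw [Yd_eq_fderiv, ← hf.lineDeriv_eq_fderiv, h.lineDeriv]

lemma sum_sq_fields (w z : Heis n) :
    ∑ i : Fin n, (xField w i z ^ 2 + yField w i z ^ 2) = gaugeQuartic w z * horizSq w z := by
  conv_rhs => rw [horizSq, Finset.mul_sum]
  refine Finset.sum_congr rfl fun i _ => ?_
  simp only [xField, yField, gaugeQuartic]; ring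

lemma continuous_Xd {f : Heis n → ℝ} (hf : ContDiff ℝ 1 f) (i : Fin n) :
    Continuous (Xd i f) := by
  have := hf.continuous_fderiv one_ne_zero
  unfold Xd grad
  fun_prop

lemma continuous_Yd {f : Heis n → ℝ} (hf : ContDiff ℝ 1 f) (i : Fin n) :
    Continuous (Yd i f) := by
  have := hf.continuous_fderiv one_ne_zero
  unfold Yd grad
  fun_prop

lemma Xd_eq_zero_of_notMem_tsupport {f : Heis n → ℝ} {z : Heis n} (hz : z ∉ tsupport f)
    (i : Fin n) : Xd i f z = 0 := by
  simp [Xd_eq_fderiv, fderiv_of_notMem_tsupport ℝ hz]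

lemma Yd_eq_zero_of_notMem_tsupport {f : Heis n → ℝ} {z : Heis n} (hz : z ∉ tsupport f)
    (i : Fin n) : Yd i f z = 0 := by
  simp [Yd_eq_fderiv, fderiv_of_notMem_tsupport ℝ hz]

lemma integrable_Xd {f : Heis n → ℝ} (hf : ContDiff ℝ 1 f) (hc : HasCompactSupport f)
    (i : Fin n) : Integrable (Xd i f) :=
  (continuous_Xd hf i).integrable_of_hasCompactSupport <|
    hc.mono' fun _ hz => by_contra fun h => hz (Xd_eq_zero_of_notMem_tsupport h i)

lemma integrable_Yd {f : Heis n → ℝ} (hf : ContDiff ℝ 1 f) (hc : HasCompactSupport f)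
    (i : Fin n) : Integrable (Yd i f) :=
  (continuous_Yd hf i).integrable_of_hasCompactSupport <|
    hc.mono' fun _ hz => by_contra fun h => hz (Yd_eq_zero_of_notMem_tsupport h i)

lemma integral_mul_fderiv_eq_zero {g f : Heis n → ℝ} (hg : ContDiff ℝ 1 g) (hf : ContDiff ℝ 1 f)
    (hc : HasCompactSupport f) (v : Heis n) (h0 : ∀ z, fderiv ℝ g z v = 0) :
    Integrable (fun z => g z * fderiv ℝ f z v) ∧ ∫ z, g z * fderiv ℝ f z v = 0 := by
  have hcf := hf.continuous_fderiv one_ne_zero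
  have hcg := hg.continuous
  have hcf' := hf.continuous
  have h1 : Integrable (fun z => g z * fderiv ℝ f z v) :=
    Continuous.integrable_of_hasCompactSupport (by fun_prop) (hc.fderiv_apply ℝ v).mul_left
  refine ⟨h1, ?_⟩
  rw [integral_mul_fderiv_eq_neg_fderiv_mul_of_integrable (by simp [h0]) h1
    (Continuous.integrable_of_hasCompactSupport (by fun_prop) hc.mul_left)
    (fun z _ => hg.differentiable one_ne_zero z) (fun z _ => hf.differentiable one_ne_zero z)]
  simp [h0]

lemma fderiv_coord_single {j k : Fin (2 * n + 1)} (h : j ≠ k) (c : ℝ) (z : Heis n) :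
    fderiv ℝ (fun z : Heis n => c * z j) z (Pi.single k 1) = 0 := by
  have : DifferentiableAt ℝ (fun z : Heis n => c * z j) z := by fun_prop
  rw [← this.lineDeriv_eq_fderiv]
  have h' : HasDerivAt _ _ _ := hasLineDerivAt_coord j z (Pi.single k 1)
  have h2 : HasLineDerivAt ℝ (fun z : Heis n => c * z j) _ z (Pi.single k 1) := h'.const_mul c
  rw [h2.lineDeriv]; simp [h]

lemma integral_Xd {f : Heis n → ℝ} (hf : ContDiff ℝ 1 f) (hc : HasCompactSupport f)
    (i : Fin n) : ∫ z, Xd i f z = 0 := by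
  have h2 : yIdx n i ≠ tIdx n := yIdx_ne_tIdx i
  have hx := integral_mul_fderiv_eq_zero (g := fun _ => 1) contDiff_const hf hc
    (Pi.single (xIdx n i) 1) (by simp)
  have ht := integral_mul_fderiv_eq_zero (g := fun z => 2 * z (yIdx n i)) (by fun_prop) hf hc
    (Pi.single (tIdx n) 1) (fderiv_coord_single h2 2)
  have := integral_add hx.1 ht.1
  rw [hx.2, ht.2, add_zero] at this
  rw [← this]; simp [Xd, grad]

lemma integral_Yd {f : Heis n → ℝ} (hf : ContDiff ℝ 1 f) (hc : HasCompactSupport f)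
    (i : Fin n) : ∫ z, Yd i f z = 0 := by
  have h2 : xIdx n i ≠ tIdx n := xIdx_ne_tIdx i
  have hx := integral_mul_fderiv_eq_zero (g := fun _ => 1) contDiff_const hf hc
    (Pi.single (yIdx n i) 1) (by simp)
  have ht := integral_mul_fderiv_eq_zero (g := fun z => 2 * z (xIdx n i)) (by fun_prop) hf hc
    (Pi.single (tIdx n) 1) (fderiv_coord_single h2 2)
  have := integral_sub hx.1 ht.1
  rw [hx.2, ht.2, sub_zero] at this
  rw [← this]; simp [Yd, grad]

lemma Xd_weighted_xField_mul {w z : Heis n} (hz : z ≠ w) {ε : ℝ} (hε : 0 < ε) (γ q : ℝ)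
    {φ : Heis n → ℝ} (hφ : DifferentiableAt ℝ φ z) (i : Fin n) :
    Xd i (fun z => gaugeQuartic w z ^ γ * (horizSq w z + ε) ^ q * xField w i z * φ z) z =
      gaugeQuartic w z ^ γ * (horizSq w z + ε) ^ q * (xField w i z * Xd i φ z)
      + φ z * (4 * γ * gaugeQuartic w z ^ (γ - 1) * (horizSq w z + ε) ^ q * xField w i z ^ 2
        + 2 * q * gaugeQuartic w z ^ γ * (horizSq w z + ε) ^ (q - 1)
          * ((z (xIdx n i) - w (xIdx n i)) * xField w i z)
        + gaugeQuartic w z ^ γ * (horizSq w z + ε) ^ q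
          * (2 * (z (xIdx n i) - w (xIdx n i)) ^ 2 + horizSq w z
            + 2 * (z (yIdx n i) - w (yIdx n i)) ^ 2)) := by
  have hN := gaugeQuartic_pos hz
  have hS : 0 < horizSq w z + ε := add_pos_of_nonneg_of_pos (horizSq_nonneg w z) hε
  have h1 : HasDerivAt _ _ _ := hasLineDerivAt_gaugeQuartic_xVec w z i
  have h2 : HasDerivAt _ _ _ := hasLineDerivAt_horizSq_xVec w z i
  have h3 : HasDerivAt _ _ _ := hasLineDerivAt_xField w z i
  have h4 : HasDerivAt _ _ _ := hφ.hasFDerivAt.hasLineDerivAt (xVec i z)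
  refine Xd_eq_of_hasLineDerivAt ?_ ?_
  · have a : DifferentiableAt ℝ (gaugeQuartic w) z :=
      (contDiff_gaugeQuartic w (m := 1)).differentiable one_ne_zero z
    have b : DifferentiableAt ℝ (horizSq w) z :=
      (contDiff_horizSq w (m := 1)).differentiable one_ne_zero z
    have c : DifferentiableAt ℝ (xField w i) z :=
      (contDiff_xField w i (m := 1)).differentiable one_ne_zero z
    exact (((a.rpow_const (Or.inl hN.ne')).fun_mul
      ((b.add_const ε).rpow_const (Or.inl hS.ne'))).fun_mul c).fun_mul hφ
  · refine ((((h1.rpow_const (p := γ) (Or.inl (by simpa using hN.ne'))).fun_mul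
      ((h2.add_const ε).rpow_const (p := q) (Or.inl (by simpa using hS.ne')))).fun_mul h3).fun_mul
        h4).congr_deriv ?_
    simp only [zero_smul, add_zero, ← Xd_eq_fderiv]; ring

lemma Yd_weighted_yField_mul {w z : Heis n} (hz : z ≠ w) {ε : ℝ} (hε : 0 < ε) (γ q : ℝ)
    {φ : Heis n → ℝ} (hφ : DifferentiableAt ℝ φ z) (i : Fin n) :
    Yd i (fun z => gaugeQuartic w z ^ γ * (horizSq w z + ε) ^ q * yField w i z * φ z) z =
      gaugeQuartic w z ^ γ * (horizSq w z + ε) ^ q * (yField w i z * Yd i φ z)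
      + φ z * (4 * γ * gaugeQuartic w z ^ (γ - 1) * (horizSq w z + ε) ^ q * yField w i z ^ 2
        + 2 * q * gaugeQuartic w z ^ γ * (horizSq w z + ε) ^ (q - 1)
          * ((z (yIdx n i) - w (yIdx n i)) * yField w i z)
        + gaugeQuartic w z ^ γ * (horizSq w z + ε) ^ q
          * (2 * (z (xIdx n i) - w (xIdx n i)) ^ 2 + horizSq w z
            + 2 * (z (yIdx n i) - w (yIdx n i)) ^ 2)) := by
  have hN := gaugeQuartic_pos hz
  have hS : 0 < horizSq w z + ε := add_pos_of_nonneg_of_pos (horizSq_nonneg w z) hε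
  have h1 : HasDerivAt _ _ _ := hasLineDerivAt_gaugeQuartic_yVec w z i
  have h2 : HasDerivAt _ _ _ := hasLineDerivAt_horizSq_yVec w z i
  have h3 : HasDerivAt _ _ _ := hasLineDerivAt_yField w z i
  have h4 : HasDerivAt _ _ _ := hφ.hasFDerivAt.hasLineDerivAt (yVec i z)
  refine Yd_eq_of_hasLineDerivAt ?_ ?_
  · have a : DifferentiableAt ℝ (gaugeQuartic w) z :=
      (contDiff_gaugeQuartic w (m := 1)).differentiable one_ne_zero z
    have b : DifferentiableAt ℝ (horizSq w) z :=
      (contDiff_horizSq w (m := 1)).differentiable one_ne_zero z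
    have c : DifferentiableAt ℝ (yField w i) z :=
      (contDiff_yField w i (m := 1)).differentiable one_ne_zero z
    exact (((a.rpow_const (Or.inl hN.ne')).fun_mul
      ((b.add_const ε).rpow_const (Or.inl hS.ne'))).fun_mul c).fun_mul hφ
  · refine ((((h1.rpow_const (p := γ) (Or.inl (by simpa using hN.ne'))).fun_mul
      ((h2.add_const ε).rpow_const (p := q) (Or.inl (by simpa using hS.ne')))).fun_mul h3).fun_mul
        h4).congr_deriv ?_
    simp only [zero_smul, add_zero, ← Yd_eq_fderiv]; ring

/-- The horizontal divergence of the regularised `p`-flux of the fundamental solution, tested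
against `φ`. -/
lemma sum_Xd_add_Yd_weighted {w z : Heis n} (hz : z ≠ w) {ε : ℝ} (hε : 0 < ε) (p : ℝ)
    {φ : Heis n → ℝ} (hφ : DifferentiableAt ℝ φ z) :
    ∑ i : Fin n,
      (Xd i (fun z => gaugeQuartic w z ^ (-(2 * (n : ℝ) + 2 + p) / 4)
          * (horizSq w z + ε) ^ ((p - 2) / 2) * xField w i z * φ z) z
        + Yd i (fun z => gaugeQuartic w z ^ (-(2 * (n : ℝ) + 2 + p) / 4)
          * (horizSq w z + ε) ^ ((p - 2) / 2) * yField w i z * φ z) z) =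
      gaugeQuartic w z ^ (-(2 * (n : ℝ) + 2 + p) / 4) *
        ((horizSq w z + ε) ^ ((p - 2) / 2)
            * (∑ i : Fin n, (xField w i z * Xd i φ z + yField w i z * Yd i φ z))
          + φ z * ((2 - p) * horizSq w z * ε * (horizSq w z + ε) ^ ((p - 2) / 2 - 1))) := by
  have hN := gaugeQuartic_pos hz
  have hS : 0 < horizSq w z + ε := add_pos_of_nonneg_of_pos (horizSq_nonneg w z) hε
  simp only [Xd_weighted_xField_mul hz hε _ _ hφ, Yd_weighted_yField_mul hz hε _ _ hφ]
  set γ : ℝ := -(2 * (n : ℝ) + 2 + p) / 4 with hγ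
  set q : ℝ := (p - 2) / 2 with hq
  have e1 : gaugeQuartic w z ^ γ = gaugeQuartic w z ^ (γ - 1) * gaugeQuartic w z := by
    rw [Real.rpow_sub_one hN.ne', div_mul_cancel₀ _ hN.ne']
  have e2 : (horizSq w z + ε) ^ q = (horizSq w z + ε) ^ (q - 1) * (horizSq w z + ε) := by
    rw [Real.rpow_sub_one hS.ne', div_mul_cancel₀ _ hS.ne']
  rw [e1, e2]
  generalize gaugeQuartic w z ^ (γ - 1) = A
  generalize (horizSq w z + ε) ^ (q - 1) = B
  have key : ∀ i : Fin n, ((z (xIdx n i) - w (xIdx n i)) * xField w i z)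
      + ((z (yIdx n i) - w (yIdx n i)) * yField w i z)
      = horizSq w z * ((z (xIdx n i) - w (xIdx n i)) ^ 2 + (z (yIdx n i) - w (yIdx n i)) ^ 2) :=
    fun i => by simp only [xField, yField]; ring
  have s1 := sum_sq_fields w z
  have s2 : ∑ i : Fin n, ((z (xIdx n i) - w (xIdx n i)) ^ 2 + (z (yIdx n i) - w (yIdx n i)) ^ 2)
    = horizSq w z := rfl
  set S := horizSq w z
  set N := gaugeQuartic w z
  calc _ = ∑ i : Fin n, (A * N * (B * (S + ε)) * (xField w i z * Xd i φ z + yField w i z * Yd i φ z)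
        + φ z * (4 * γ * A * (B * (S + ε))) * (xField w i z ^ 2 + yField w i z ^ 2)
        + φ z * (2 * q * (A * N) * B * S + 4 * (A * N * (B * (S + ε))))
          * ((z (xIdx n i) - w (xIdx n i)) ^ 2 + (z (yIdx n i) - w (yIdx n i)) ^ 2)
        + φ z * (2 * (A * N * (B * (S + ε))) * S)) :=
        Finset.sum_congr rfl fun i _ => by
          linear_combination (φ z * (2 * q * (A * N) * B)) * key i
    _ = _ := by
      simp only [Finset.sum_add_distrib, ← Finset.mul_sum]
      rw [← Finset.sum_add_distrib, ← Finset.sum_add_distrib, ← Finset.sum_add_distrib, s1, s2]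
      simp only [Finset.sum_const, Finset.card_univ, Fintype.card_fin, nsmul_eq_mul]
      rw [hγ, hq]; ring

lemma contDiff_mul_of_tsupport_subset {w : Heis n} {F φ : Heis n → ℝ}
    (hF : ∀ z ≠ w, ContDiffAt ℝ 1 F z) (hφ : ContDiff ℝ 1 φ) (hs : tsupport φ ⊆ {w}ᶜ) :
    ContDiff ℝ 1 (fun z => F z * φ z) := by
  refine contDiff_iff_contDiffAt.2 fun z => ?_
  by_cases hz : z ∈ tsupport φ
  · exact (hF z (hs hz)).mul hφ.contDiffAt
  · refine (contDiffAt_const (c := (0 : ℝ))).congr_of_eventuallyEq ?_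
    filter_upwards [notMem_tsupport_iff_eventuallyEq.1 hz] with y hy
    simp [hy]

lemma continuous_mul_of_eq_zero {w : Heis n} {F φ g : Heis n → ℝ}
    (hF : ContinuousOn F {w}ᶜ) (hg : Continuous g) (hs : tsupport φ ⊆ {w}ᶜ)
    (h0 : ∀ z ∉ tsupport φ, g z = 0) : Continuous (fun z => F z * g z) := by
  refine continuous_iff_continuousAt.2 fun z => ?_
  by_cases hz : z ∈ tsupport φ
  · exact (hF.continuousAt (isOpen_compl_singleton.mem_nhds (hs hz))).mul hg.continuousAt
  · refine (continuousAt_const (y := (0 : ℝ))).congr ?_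
    filter_upwards [(isClosed_tsupport φ).isOpen_compl.mem_nhds hz] with y hy
    simp [h0 y hy]

lemma rpow_mul_abs_le {S N ε p f : ℝ} (hS : 0 ≤ S) (hN : 0 ≤ N) (hε : 0 < ε) (hε1 : ε ≤ 1)
    (hp : 1 < p) (hf : f ^ 2 ≤ N * S) :
    (S + ε) ^ ((p - 2) / 2) * |f| ≤ (S + 1) ^ ((p - 1) / 2) * √N := by
  have hpos : 0 < S + ε := by linarith
  have h1 : |f| ≤ √(S + ε) * √N := by
    rw [← Real.sqrt_mul hpos.le, ← Real.sqrt_sq_eq_abs]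
    exact Real.sqrt_le_sqrt (by nlinarith)
  calc (S + ε) ^ ((p - 2) / 2) * |f| ≤ (S + ε) ^ ((p - 2) / 2) * (√(S + ε) * √N) := by gcongr
    _ = (S + ε) ^ ((p - 1) / 2) * √N := by
      rw [← mul_assoc, Real.sqrt_eq_rpow (S + ε), ← Real.rpow_add hpos]
      congr 2; ring
    _ ≤ (S + 1) ^ ((p - 1) / 2) * √N := by
      gcongr

lemma mul_mul_rpow_le {S ε p : ℝ} (hS : 0 ≤ S) (hε : 0 < ε) (hε1 : ε ≤ 1) (hp : 1 < p) :
    S * ε * (S + ε) ^ ((p - 2) / 2 - 1) ≤ (S + 1) ^ (p / 2) := by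
  have hpos : 0 < S + ε := by linarith
  calc S * ε * (S + ε) ^ ((p - 2) / 2 - 1)
      ≤ (S + ε) ^ (2 : ℝ) * (S + ε) ^ ((p - 2) / 2 - 1) := by
        gcongr
        rw [Real.rpow_two]; nlinarith
    _ = (S + ε) ^ (p / 2) := by
      rw [← Real.rpow_add hpos]; congr 1; ring
    _ ≤ (S + 1) ^ (p / 2) := by gcongr

lemma xField_sq_le (w z : Heis n) (i : Fin n) :
    xField w i z ^ 2 ≤ gaugeQuartic w z * horizSq w z := by
  have := Finset.single_le_sum (f := fun i => xField w i z ^ 2 + yField w i z ^ 2)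
    (fun _ _ => by positivity) (Finset.mem_univ i)
  rw [sum_sq_fields] at this
  nlinarith [sq_nonneg (yField w i z)]

lemma yField_sq_le (w z : Heis n) (i : Fin n) :
    yField w i z ^ 2 ≤ gaugeQuartic w z * horizSq w z := by
  have := Finset.single_le_sum (f := fun i => xField w i z ^ 2 + yField w i z ^ 2)
    (fun _ _ => by positivity) (Finset.mem_univ i)
  rw [sum_sq_fields] at this
  nlinarith [sq_nonneg (xField w i z)]

lemma continuousOn_gaugeQuartic_rpow (w : Heis n) (γ : ℝ) :
    ContinuousOn (fun z => gaugeQuartic w z ^ γ) {w}ᶜ :=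
  (contDiff_gaugeQuartic w (m := 1)).continuous.continuousOn.rpow_const
    fun _ hz => Or.inl (gaugeQuartic_pos hz).ne'

lemma contDiffAt_weight {w z : Heis n} (hz : z ≠ w) {ε : ℝ} (hε : 0 < ε) (γ q : ℝ) :
    ContDiffAt ℝ 1 (fun z => gaugeQuartic w z ^ γ * (horizSq w z + ε) ^ q) z := by
  have hS : 0 < horizSq w z + ε := add_pos_of_nonneg_of_pos (horizSq_nonneg w z) hε
  exact ((contDiff_gaugeQuartic w).contDiffAt.rpow_const_of_ne (gaugeQuartic_pos hz).ne').mul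
    (((contDiff_horizSq w).contDiffAt.add contDiffAt_const).rpow_const_of_ne hS.ne')

lemma integral_weighted_flux_eq_zero {p : ℝ} (hp : 1 < p) (w : Heis n) {φ : Heis n → ℝ}
    (hφ : ContDiff ℝ 1 φ) (hc : HasCompactSupport φ) (hs : tsupport φ ⊆ {w}ᶜ) :
    ∫ z, gaugeQuartic w z ^ (-(2 * (n : ℝ) + 2 + p) / 4) * (horizSq w z ^ ((p - 2) / 2) *
      ∑ i : Fin n, (xField w i z * Xd i φ z + yField w i z * Yd i φ z)) = 0 := by
  set γ : ℝ := -(2 * (n : ℝ) + 2 + p) / 4 with hγ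
  set q : ℝ := (p - 2) / 2 with hq
  set ε : ℕ → ℝ := fun k => 1 / ((k : ℝ) + 1) with hεdef
  have hε : ∀ k, 0 < ε k := fun k => by positivity
  have hε1 : ∀ k, ε k ≤ 1 := fun k => by
    rw [hεdef]; exact (div_le_one (by positivity)).2 (by linarith [k.cast_nonneg (α := ℝ)])
  have hε0 : Filter.Tendsto ε Filter.atTop (nhds 0) := tendsto_one_div_add_atTop_nhds_zero_nat
  set F : ℕ → Fin n → Heis n → ℝ := fun k i z =>
    gaugeQuartic w z ^ γ * (horizSq w z + ε k) ^ q * xField w i z * φ z with hF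
  set G : ℕ → Fin n → Heis n → ℝ := fun k i z =>
    gaugeQuartic w z ^ γ * (horizSq w z + ε k) ^ q * yField w i z * φ z with hG
  have hF1 : ∀ k i, ContDiff ℝ 1 (F k i) := fun k i =>
    contDiff_mul_of_tsupport_subset (fun z hz => (contDiffAt_weight hz (hε k) γ q).mul
      (contDiff_xField w i).contDiffAt) hφ hs
  have hG1 : ∀ k i, ContDiff ℝ 1 (G k i) := fun k i =>
    contDiff_mul_of_tsupport_subset (fun z hz => (contDiffAt_weight hz (hε k) γ q).mul
      (contDiff_yField w i).contDiffAt) hφ hs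
  have hFc : ∀ k i, HasCompactSupport (F k i) := fun k i => hc.mul_left
  have hGc : ∀ k i, HasCompactSupport (G k i) := fun k i => hc.mul_left
  have hF0 : ∀ k i, tsupport (F k i) ⊆ tsupport φ := fun k i => tsupport_mul_subset_right
  have hG0 : ∀ k i, tsupport (G k i) ⊆ tsupport φ := fun k i => tsupport_mul_subset_right
  have hzero : ∀ k, ∫ z, ∑ i : Fin n, (Xd i (F k i) z + Yd i (G k i) z) = 0 := fun k => by
    refine (integral_finsetSum _ fun i _ =>
      (integrable_Xd (hF1 k i) (hFc k i) i).fun_add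
        (integrable_Yd (hG1 k i) (hGc k i) i)).trans ?_
    refine Finset.sum_eq_zero fun i _ => ?_
    rw [integral_add (integrable_Xd (hF1 k i) (hFc k i) i) (integrable_Yd (hG1 k i) (hGc k i) i),
      integral_Xd (hF1 k i) (hFc k i), integral_Yd (hG1 k i) (hGc k i), add_zero]
  have hform : ∀ k, ∀ z ∈ tsupport φ, ∑ i : Fin n, (Xd i (F k i) z + Yd i (G k i) z) =
      gaugeQuartic w z ^ γ * ((horizSq w z + ε k) ^ q
          * (∑ i : Fin n, (xField w i z * Xd i φ z + yField w i z * Yd i φ z))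
        + φ z * ((2 - p) * horizSq w z * ε k * (horizSq w z + ε k) ^ (q - 1))) := fun k z hz =>
    sum_Xd_add_Yd_weighted (hs hz) (hε k) p (hφ.differentiable one_ne_zero z)
  have houtF : ∀ k, ∀ z ∉ tsupport φ, ∑ i : Fin n, (Xd i (F k i) z + Yd i (G k i) z) = 0 :=
    fun k z hz => Finset.sum_eq_zero fun i _ => by
      rw [Xd_eq_zero_of_notMem_tsupport fun h => hz (hF0 k i h),
        Yd_eq_zero_of_notMem_tsupport fun h => hz (hG0 k i h), add_zero]
  set g : Heis n → ℝ := fun z =>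
    (horizSq w z + 1) ^ ((p - 1) / 2) * √(gaugeQuartic w z)
        * ∑ i : Fin n, (|Xd i φ z| + |Yd i φ z|)
      + |2 - p| * (horizSq w z + 1) ^ (p / 2) * |φ z| with hg
  have hg0 : ∀ z ∉ tsupport φ, g z = 0 := fun z hz => by
    simp [hg, Xd_eq_zero_of_notMem_tsupport hz, Yd_eq_zero_of_notMem_tsupport hz,
      image_eq_zero_of_notMem_tsupport hz]
  have hgcont : Continuous g := by
    have a := (contDiff_gaugeQuartic w (m := 1)).continuous
    have b := (contDiff_horizSq w (m := 1)).continuous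
    have c := hφ.continuous
    have d := fun i => continuous_Xd hφ i
    have e := fun i => continuous_Yd hφ i
    have r (s : ℝ) : Continuous fun z => (horizSq w z + 1) ^ s :=
      (b.add continuous_const).rpow_const fun z =>
        Or.inl (add_pos_of_nonneg_of_pos (horizSq_nonneg w z) one_pos).ne'
    have r1 := r ((p - 1) / 2)
    have r2 := r (p / 2)
    fun_prop
  have hlim := tendsto_integral_of_dominated_convergence
    (F := fun k z => ∑ i : Fin n, (Xd i (F k i) z + Yd i (G k i) z))
    (f := fun z => gaugeQuartic w z ^ γ * (horizSq w z ^ q *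
      ∑ i : Fin n, (xField w i z * Xd i φ z + yField w i z * Yd i φ z)))
    (μ := volume) (fun z => gaugeQuartic w z ^ γ * g z) ?_ ?_ ?_ ?_
  · simp only [hzero] at hlim
    exact (tendsto_nhds_unique hlim tendsto_const_nhds)
  · exact fun k => (continuous_finsetSum _ fun i _ =>
      (continuous_Xd (hF1 k i) i).add (continuous_Yd (hG1 k i) i)).aestronglyMeasurable
  · refine (continuous_mul_of_eq_zero (continuousOn_gaugeQuartic_rpow w γ) hgcont hs
      hg0).integrable_of_hasCompactSupport ?_
    exact HasCompactSupport.mul_left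
      (hc.mono' fun z hz => by_contra fun h => hz (hg0 z h))
  · refine fun k => Filter.Eventually.of_forall fun z => ?_
    by_cases hz : z ∈ tsupport φ
    swap
    · simp [houtF k z hz, hg0 z hz]
    have hS := horizSq_nonneg w z
    have hN := gaugeQuartic_nonneg w z
    have hpos : 0 < horizSq w z + ε k := add_pos_of_nonneg_of_pos hS (hε k)
    rw [hform k z hz, Real.norm_eq_abs, abs_mul, abs_of_nonneg (Real.rpow_nonneg hN γ)]
    refine mul_le_mul_of_nonneg_left ?_ (Real.rpow_nonneg hN γ)
    refine (abs_add_le _ _).trans (add_le_add ?_ ?_)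
    · rw [Finset.mul_sum, Finset.mul_sum]
      refine (Finset.abs_sum_le_sum_abs _ _).trans (Finset.sum_le_sum fun i _ => ?_)
      have hx := rpow_mul_abs_le hS hN (hε k) (hε1 k) hp (xField_sq_le w z i)
      have hy := rpow_mul_abs_le hS hN (hε k) (hε1 k) hp (yField_sq_le w z i)
      rw [abs_mul, abs_of_nonneg (Real.rpow_nonneg hpos.le q)]
      calc (horizSq w z + ε k) ^ q * |xField w i z * Xd i φ z + yField w i z * Yd i φ z|
          ≤ (horizSq w z + ε k) ^ q
              * (|xField w i z| * |Xd i φ z| + |yField w i z| * |Yd i φ z|) := by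
            gcongr
            exact (abs_add_le _ _).trans_eq (by rw [abs_mul, abs_mul])
        _ = (horizSq w z + ε k) ^ q * |xField w i z| * |Xd i φ z|
              + (horizSq w z + ε k) ^ q * |yField w i z| * |Yd i φ z| := by ring
        _ ≤ _ := by
          rw [mul_add]
          gcongr
    · have h := mul_mul_rpow_le hS (hε k) (hε1 k) hp
      have h0 : 0 ≤ horizSq w z * ε k * (horizSq w z + ε k) ^ (q - 1) := by
        have := hε k; positivity
      calc |φ z * ((2 - p) * horizSq w z * ε k * (horizSq w z + ε k) ^ (q - 1))|
          = |2 - p| * (horizSq w z * ε k * (horizSq w z + ε k) ^ (q - 1)) * |φ z| := by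
            rw [← abs_of_nonneg h0, ← abs_mul, ← abs_mul]; congr 1; ring
        _ ≤ _ := by gcongr
  · refine Filter.Eventually.of_forall fun z => ?_
    by_cases hz : z ∈ tsupport φ
    swap
    · simp [houtF _ z hz, Xd_eq_zero_of_notMem_tsupport hz, Yd_eq_zero_of_notMem_tsupport hz]
    simp only [hform _ z hz]
    rcases (horizSq_nonneg w z).eq_or_lt with hS | hS
    · have hx : ∀ i, xField w i z = 0 := fun i => by
        have := xField_sq_le w z i
        rw [← hS, mul_zero] at this
        exact pow_eq_zero_iff two_ne_zero |>.1 (le_antisymm this (sq_nonneg _))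
      have hy : ∀ i, yField w i z = 0 := fun i => by
        have := yField_sq_le w z i
        rw [← hS, mul_zero] at this
        exact pow_eq_zero_iff two_ne_zero |>.1 (le_antisymm this (sq_nonneg _))
      simp [hx, hy, ← hS]
    · have hadd : Filter.Tendsto (fun k => horizSq w z + ε k) Filter.atTop
          (nhds (horizSq w z)) := by simpa using hε0.const_add (horizSq w z)
      have hpow (s : ℝ) := hadd.rpow_const (p := s) (Or.inl hS.ne')
      have := ((((hpow q).mul_const (∑ i : Fin n, (xField w i z * Xd i φ z
        + yField w i z * Yd i φ z))).add (((hε0.const_mul ((2 - p) * horizSq w z)).mul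
          (hpow (q - 1))).const_mul (φ z))).const_mul (gaugeQuartic w z ^ γ))
      simpa using this

lemma Xd_gaugeQuartic_rpow {w z : Heis n} (hz : z ≠ w) (β : ℝ) (i : Fin n) :
    Xd i (fun z => gaugeQuartic w z ^ β) z
      = 4 * β * gaugeQuartic w z ^ (β - 1) * xField w i z := by
  have hN := gaugeQuartic_pos hz
  refine Xd_eq_of_hasLineDerivAt (((contDiff_gaugeQuartic w (m := 1)).differentiable one_ne_zero
    z).rpow_const (Or.inl hN.ne')) ?_
  have h : HasDerivAt _ _ _ := hasLineDerivAt_gaugeQuartic_xVec w z i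
  refine (h.rpow_const (p := β) (Or.inl (by simpa using hN.ne'))).congr_deriv ?_
  simp only [zero_smul, add_zero]; ring

lemma Yd_gaugeQuartic_rpow {w z : Heis n} (hz : z ≠ w) (β : ℝ) (i : Fin n) :
    Yd i (fun z => gaugeQuartic w z ^ β) z
      = 4 * β * gaugeQuartic w z ^ (β - 1) * yField w i z := by
  have hN := gaugeQuartic_pos hz
  refine Yd_eq_of_hasLineDerivAt (((contDiff_gaugeQuartic w (m := 1)).differentiable one_ne_zero
    z).rpow_const (Or.inl hN.ne')) ?_
  have h : HasDerivAt _ _ _ := hasLineDerivAt_gaugeQuartic_yVec w z i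
  refine (h.rpow_const (p := β) (Or.inl (by simpa using hN.ne'))).congr_deriv ?_
  simp only [zero_smul, add_zero]; ring

lemma hNorm_gaugeQuartic_rpow {w z : Heis n} (hz : z ≠ w) (β : ℝ) :
    hNorm (fun z => gaugeQuartic w z ^ β) z
      = 4 * |β| * gaugeQuartic w z ^ (β - 1 / 2) * horizSq w z ^ ((1 : ℝ) / 2) := by
  have hN := gaugeQuartic_pos hz
  have hS := horizSq_nonneg w z
  have h0 := Real.rpow_nonneg hN.le (β - 1)
  simp only [hNorm, Xd_gaugeQuartic_rpow hz, Yd_gaugeQuartic_rpow hz, mul_pow _ (xField _ _ _),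
    mul_pow _ (yField _ _ _), ← mul_add, ← Finset.mul_sum, sum_sq_fields]
  rw [Real.sqrt_mul (sq_nonneg _), Real.sqrt_sq_eq_abs, Real.sqrt_mul hN.le, abs_mul, abs_mul,
    abs_of_nonneg h0, Real.sqrt_eq_rpow, Real.sqrt_eq_rpow,
    show β - 1 / 2 = (β - 1) + 1 / 2 by ring, Real.rpow_add hN, abs_of_pos four_pos]
  ring

end Heis

/-- For `p > 1`, `p ≠ Q = 2n+2`, the function
`v_w(z) = ρ(w⁻¹ ⬝ z)^(−(Q−p)/(p−1))` is weakly horizontally `p`-harmonic in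
`ℍⁿ ∖ {w}`. -/
theorem fundamental_solution_pHarmonic
    (n : ℕ) (hn : 1 ≤ n) (p : ℝ) (hp : 1 < p) (hpQ : p ≠ 2 * (n : ℝ) + 2)
    (w : Heis n) :
    Heis.PHarmonicOn p
      (fun z => Heis.rho (Heis.mul (Heis.inv w) z)
        ^ (-((2 * (n : ℝ) + 2 - p) / (p - 1))))
      ({w}ᶜ) := by
  have hf : (fun z => Heis.rho (Heis.mul (Heis.inv w) z) ^ (-((2 * (n : ℝ) + 2 - p) / (p - 1))))
      = fun z => Heis.gaugeQuartic w z ^ (1 / 4 * -((2 * (n : ℝ) + 2 - p) / (p - 1))) := by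
    funext z
    rw [Heis.rho_mul_inv, ← Real.rpow_mul (Heis.gaugeQuartic_nonneg w z)]
  rw [hf]
  set β : ℝ := 1 / 4 * -((2 * (n : ℝ) + 2 - p) / (p - 1)) with hβ
  have hmeas : MeasurableSet ({w}ᶜ : Set (Heis n)) := (measurableSet_singleton w).compl
  have hp0 : 0 ≤ p := by linarith
  refine ⟨?_, ?_, fun φ hφ hc hs => ?_⟩
  · exact ((Heis.continuousOn_gaugeQuartic_rpow w β).abs.rpow_const
      fun _ _ => Or.inr hp0).locallyIntegrableOn hmeas
  · have : ContinuousOn (fun z => (4 * |β| * Heis.gaugeQuartic w z ^ (β - 1 / 2)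
        * Heis.horizSq w z ^ ((1 : ℝ) / 2)) ^ p) {w}ᶜ :=
      ((continuousOn_const.mul (Heis.continuousOn_gaugeQuartic_rpow w _)).mul
        ((Heis.contDiff_horizSq w (m := 1)).continuous.continuousOn.rpow_const
          fun _ _ => Or.inr (by norm_num))).rpow_const fun _ _ => Or.inr hp0
    refine (this.congr fun z hz => ?_).locallyIntegrableOn hmeas
    simp only [Heis.hNorm_gaugeQuartic_rpow hz]
  · have hexp : (β - 1 / 2) * (p - 2) + (β - 1) = -(2 * (n : ℝ) + 2 + p) / 4 := by
      have : p - 1 ≠ 0 := by linarith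
      rw [hβ]; field_simp; ring
    have key : ∀ z ∈ ({w}ᶜ : Set (Heis n)),
        Heis.hNorm (fun z => Heis.gaugeQuartic w z ^ β) z ^ (p - 2) *
          (∑ i : Fin n, (Heis.Xd i (fun z => Heis.gaugeQuartic w z ^ β) z * Heis.Xd i φ z
            + Heis.Yd i (fun z => Heis.gaugeQuartic w z ^ β) z * Heis.Yd i φ z))
        = (4 * |β|) ^ (p - 2) * (4 * β) *
          (Heis.gaugeQuartic w z ^ (-(2 * (n : ℝ) + 2 + p) / 4) *
            (Heis.horizSq w z ^ ((p - 2) / 2) * ∑ i : Fin n,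
              (Heis.xField w i z * Heis.Xd i φ z + Heis.yField w i z * Heis.Yd i φ z))) := by
      intro z hz
      have hN := Heis.gaugeQuartic_pos hz
      have hS := Heis.horizSq_nonneg w z
      have hsum : ∑ i : Fin n, (Heis.Xd i (fun z => Heis.gaugeQuartic w z ^ β) z * Heis.Xd i φ z
            + Heis.Yd i (fun z => Heis.gaugeQuartic w z ^ β) z * Heis.Yd i φ z)
          = 4 * β * Heis.gaugeQuartic w z ^ (β - 1) * ∑ i : Fin n,
              (Heis.xField w i z * Heis.Xd i φ z + Heis.yField w i z * Heis.Yd i φ z) := by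
        rw [Finset.mul_sum]
        refine Finset.sum_congr rfl fun i _ => ?_
        rw [Heis.Xd_gaugeQuartic_rpow hz, Heis.Yd_gaugeQuartic_rpow hz]; ring
      rw [hsum, Heis.hNorm_gaugeQuartic_rpow hz, Real.mul_rpow (by positivity) (by positivity),
        Real.mul_rpow (by positivity) (by positivity), ← Real.rpow_mul hN.le, ← Real.rpow_mul hS,
        ← hexp, Real.rpow_add hN, show (1 : ℝ) / 2 * (p - 2) = (p - 2) / 2 by ring]
      ring
    rw [setIntegral_congr_fun hmeas key, integral_const_mul,
      setIntegral_eq_integral_of_forall_compl_eq_zero,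
      Heis.integral_weighted_flux_eq_zero hp w hφ hc hs, mul_zero]
    intro z hz
    have hz' : z ∉ tsupport φ := fun h => hz (hs h)
    simp [Heis.Xd_eq_zero_of_notMem_tsupport hz', Heis.Yd_eq_zero_of_notMem_tsupport hz']
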